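/- Let u, v ∈ ℂ with Re u > 1 and Re v > 1, and let n ∈ ℤ. Then ∫₀¹ ζ₁(u,α) ζ₁(v,α) e^{−2πinα} dα = ∫₁^∞ α^{−(u+v)} e^{−2πinα} dα + ∫₁^∞ α^{−v} ζ₁(u,α) e^{−2πinα} dα + ∫₁^∞ α^{−u} ζ₁(v,α) e^{−2πinα} dα. -/

import Mathlib

open Complex MeasureTheory Real

/-- The modified Hurwitz zeta function `ζ₁(s, α) = ∑_{n=1}^∞ (n+α)^{-s}`,
as an absolutely convergent series (valid for `Re s > 1`, `α > 0`). -/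
noncomputable def zeta1 (s : ℂ) (α : ℝ) : ℂ := ∑' n : ℕ, (((n : ℂ) + 1) + (α : ℂ)) ^ (-s)

/-- A telescoping formula: the integral over `(1, ∞)` of the backward difference of a function
vanishing at infinity is the integral of that function over `[0, 1]`. -/
theorem integral_Ioi_sub_shift {G : ℝ → ℂ} (hG : ContinuousOn G (Set.Ici 0))
    (hlim : Filter.Tendsto G Filter.atTop (nhds 0))
    (hint : IntegrableOn (fun x => G (x - 1) - G x) (Set.Ioi 1)) :
    ∫ x in Set.Ioi (1 : ℝ), (G (x - 1) - G x) = ∫ x in (0 : ℝ)..1, G x := by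
  have hii : ∀ a b : ℝ, 0 ≤ a → 0 ≤ b → IntervalIntegrable G volume a b := fun a b ha hb =>
    (hG.mono fun x hx => (le_inf ha hb).trans hx.1).intervalIntegrable
  have htail : Filter.Tendsto (fun T : ℝ => ∫ x in (T - 1)..T, G x) Filter.atTop (nhds 0) := by
    rw [Metric.tendsto_atTop] at hlim ⊢
    intro ε hε
    obtain ⟨M, hM⟩ := hlim (ε / 2) (half_pos hε)
    refine ⟨M + 1, fun T hT => ?_⟩
    rw [dist_zero_right]
    have hle : ‖∫ x in (T - 1)..T, G x‖ ≤ ε / 2 * |T - (T - 1)| := by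
      refine intervalIntegral.norm_integral_le_of_norm_le_const fun x hx => ?_
      rw [Set.uIoc_of_le (by linarith)] at hx
      have := hM x (by linarith [hx.1])
      rw [dist_zero_right] at this
      exact this.le
    rw [sub_sub_cancel, abs_one, mul_one] at hle
    linarith
  refine tendsto_nhds_unique
    (intervalIntegral_tendsto_integral_Ioi 1 hint Filter.tendsto_id) ?_
  have hsub := (tendsto_const_nhds (x := ∫ x in (0 : ℝ)..1, G x)).sub htail
  rw [sub_zero] at hsub
  refine hsub.congr' ?_
  filter_upwards [Filter.eventually_ge_atTop 1] with T hT
  have hshift : IntervalIntegrable (fun x => G (x - 1)) volume 1 T := by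
    simpa using (hii 0 (T - 1) le_rfl (by linarith)).comp_sub_right 1
  rw [id, intervalIntegral.integral_sub hshift (hii 1 T (by linarith) (by linarith)),
    intervalIntegral.integral_comp_sub_right, sub_self]
  exact (intervalIntegral.integral_interval_sub_interval_comm (hii _ _ le_rfl (by linarith))
    (hii _ _ (by linarith) (by linarith)) (hii _ _ le_rfl (by linarith))).symm

theorem norm_zeta1_term (s : ℂ) (k : ℕ) {α : ℝ} (hα : -1 < α) :
    ‖(((k : ℂ) + 1) + (α : ℂ)) ^ (-s)‖ = ((k : ℝ) + 1 + α) ^ (-s.re) := by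
  have hk : (0 : ℝ) ≤ k := k.cast_nonneg
  have h : ((k : ℂ) + 1) + (α : ℂ) = (((k : ℝ) + 1 + α : ℝ) : ℂ) := by push_cast; ring
  rw [h, Complex.norm_cpow_eq_rpow_re_of_pos (by linarith), Complex.neg_re]

theorem norm_zeta1_term_le {s : ℂ} (hs : 1 < s.re) (k : ℕ) {α : ℝ} (hα : 0 ≤ α) :
    ‖(((k : ℂ) + 1) + (α : ℂ)) ^ (-s)‖ ≤ ((k : ℝ) + 1) ^ (-s.re) := by
  rw [norm_zeta1_term s k (by linarith)]
  exact Real.rpow_le_rpow_of_nonpos (by positivity) (by linarith) (by linarith)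

theorem summable_nat_add_one_rpow_neg {σ : ℝ} (hσ : 1 < σ) :
    Summable fun k : ℕ => ((k : ℝ) + 1) ^ (-σ) := by
  have := (summable_nat_add_iff 1).2 (Real.summable_nat_rpow.2 (neg_lt_neg hσ))
  simpa using this

theorem summable_zeta1 {s : ℂ} (hs : 1 < s.re) {α : ℝ} (hα : 0 ≤ α) :
    Summable fun k : ℕ => (((k : ℂ) + 1) + (α : ℂ)) ^ (-s) :=
  .of_norm_bounded (summable_nat_add_one_rpow_neg hs) fun k => norm_zeta1_term_le hs k hα

theorem zeta1_sub_one {s : ℂ} (hs : 1 < s.re) {α : ℝ} (hα : 1 ≤ α) :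
    zeta1 s (α - 1) = (α : ℂ) ^ (-s) + zeta1 s α := by
  unfold zeta1
  rw [(summable_zeta1 hs (sub_nonneg.2 hα)).tsum_eq_zero_add]
  congr 1
  · push_cast; congr 1; ring
  · refine tsum_congr fun k => ?_
    push_cast; congr 1; ring

theorem continuousOn_zeta1 {s : ℂ} (hs : 1 < s.re) : ContinuousOn (zeta1 s) (Set.Ici 0) := by
  refine continuousOn_tsum (fun k => ?_) (summable_nat_add_one_rpow_neg hs)
    fun k α hα => norm_zeta1_term_le hs k hα
  refine ContinuousOn.cpow_const (by fun_prop) fun α hα => Or.inl ?_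
  have hα' : (0 : ℝ) ≤ α := hα
  simp only [Complex.add_re, Complex.natCast_re, Complex.one_re, Complex.ofReal_re]
  positivity

theorem tendsto_zeta1_atTop {s : ℂ} (hs : 1 < s.re) :
    Filter.Tendsto (zeta1 s) Filter.atTop (nhds 0) := by
  rw [← tsum_zero (α := ℂ) (β := ℕ)]
  refine tendsto_tsum_of_dominated_convergence (summable_nat_add_one_rpow_neg hs) (fun k => ?_) ?_
  · rw [tendsto_zero_iff_norm_tendsto_zero]
    refine ((tendsto_rpow_neg_atTop (y := s.re) (by linarith)).comp
      (Filter.tendsto_atTop_add_const_left _ ((k : ℝ) + 1) Filter.tendsto_id)).congr' ?_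
    filter_upwards [Filter.eventually_ge_atTop 0] with α hα
    exact (norm_zeta1_term s k (neg_one_lt_zero.trans_le hα)).symm
  · filter_upwards [Filter.eventually_ge_atTop 0] with α hα k
    exact norm_zeta1_term_le hs k hα

theorem norm_zeta1_le {s : ℂ} (hs : 1 < s.re) {α : ℝ} (hα : 0 ≤ α) :
    ‖zeta1 s α‖ ≤ ∑' k : ℕ, ((k : ℝ) + 1) ^ (-s.re) :=
  tsum_of_norm_bounded (summable_nat_add_one_rpow_neg hs).hasSum
    fun k => norm_zeta1_term_le hs k hα

theorem norm_exp_neg_two_pi_I_mul (n : ℤ) (α : ℝ) :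
    ‖Complex.exp (-(2 * π * Complex.I * (n : ℂ) * (α : ℂ)))‖ = 1 := by
  have h : -(2 * π * Complex.I * (n : ℂ) * (α : ℂ)) = ((-(2 * π * n * α) : ℝ) : ℂ) * Complex.I := by
    push_cast; ring
  rw [h, Complex.norm_exp_ofReal_mul_I]

theorem exp_neg_two_pi_I_mul_sub_one (n : ℤ) (α : ℝ) :
    Complex.exp (-(2 * π * Complex.I * (n : ℂ) * ((α - 1 : ℝ) : ℂ))) =
      Complex.exp (-(2 * π * Complex.I * (n : ℂ) * (α : ℂ))) := by
  rw [Complex.exp_eq_exp_iff_exists_int]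
  exact ⟨n, by push_cast; ring⟩

theorem integrableOn_cpow_neg_mul {s : ℂ} (hs : 1 < s.re) {f : ℝ → ℂ} {C : ℝ}
    (hf : ContinuousOn f (Set.Ioi 1)) (hC : ∀ α ∈ Set.Ioi (1 : ℝ), ‖f α‖ ≤ C) :
    IntegrableOn (fun α : ℝ => (α : ℂ) ^ (-s) * f α) (Set.Ioi 1) := by
  refine Integrable.mul_bdd (c := C) ?_ (hf.aestronglyMeasurable measurableSet_Ioi) ?_
  · exact integrableOn_Ioi_cpow_of_lt (by simpa using hs) one_pos
  · exact (ae_restrict_iff' measurableSet_Ioi).2 (.of_forall hC)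

theorem stmt_17 (u v : ℂ) (hu : 1 < u.re) (hv : 1 < v.re) (n : ℤ) :
    ∫ α in (0 : ℝ)..1,
        zeta1 u α * zeta1 v α * Complex.exp (-(2 * π * Complex.I * (n : ℂ) * (α : ℂ))) =
      (∫ α in Set.Ioi (1 : ℝ),
          (α : ℂ) ^ (-(u + v)) * Complex.exp (-(2 * π * Complex.I * (n : ℂ) * (α : ℂ))))
        + (∫ α in Set.Ioi (1 : ℝ),
            (α : ℂ) ^ (-v) * zeta1 u α * Complex.exp (-(2 * π * Complex.I * (n : ℂ) * (α : ℂ))))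
        + ∫ α in Set.Ioi (1 : ℝ),
            (α : ℂ) ^ (-u) * zeta1 v α *
              Complex.exp (-(2 * π * Complex.I * (n : ℂ) * (α : ℂ))) := by
  have hE : Continuous fun α : ℝ =>
      Complex.exp (-(2 * π * Complex.I * (n : ℂ) * (α : ℂ))) := by fun_prop
  have hIoi : Set.Ioi (1 : ℝ) ⊆ Set.Ici 0 := Set.Ioi_subset_Ici zero_le_one
  have hzint : ∀ {s t : ℂ}, 1 < s.re → 1 < t.re → IntegrableOn (fun α : ℝ =>
      (α : ℂ) ^ (-s) * zeta1 t α * Complex.exp (-(2 * π * Complex.I * (n : ℂ) * (α : ℂ))))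
      (Set.Ioi 1) := fun {s t} hs ht => by
    simp only [mul_assoc _ (zeta1 t _)]
    refine integrableOn_cpow_neg_mul hs (((continuousOn_zeta1 ht).mono hIoi).mul hE.continuousOn)
      (C := ∑' k : ℕ, ((k : ℝ) + 1) ^ (-t.re)) fun α hα => ?_
    rw [norm_mul, norm_exp_neg_two_pi_I_mul, mul_one]
    exact norm_zeta1_le ht (hIoi hα)
  have h₀ : IntegrableOn (fun α : ℝ =>
      (α : ℂ) ^ (-(u + v)) * Complex.exp (-(2 * π * Complex.I * (n : ℂ) * (α : ℂ))))
      (Set.Ioi 1) :=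
    integrableOn_cpow_neg_mul (by rw [Complex.add_re]; linarith) hE.continuousOn
      fun α _ => (norm_exp_neg_two_pi_I_mul n α).le
  have hdiff : Set.EqOn (fun α : ℝ =>
      (α : ℂ) ^ (-(u + v)) * Complex.exp (-(2 * π * Complex.I * (n : ℂ) * (α : ℂ)))
        + (α : ℂ) ^ (-v) * zeta1 u α * Complex.exp (-(2 * π * Complex.I * (n : ℂ) * (α : ℂ)))
        + (α : ℂ) ^ (-u) * zeta1 v α * Complex.exp (-(2 * π * Complex.I * (n : ℂ) * (α : ℂ))))
      (fun α : ℝ =>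
        zeta1 u (α - 1) * zeta1 v (α - 1) *
            Complex.exp (-(2 * π * Complex.I * (n : ℂ) * ((α - 1 : ℝ) : ℂ)))
          - zeta1 u α * zeta1 v α * Complex.exp (-(2 * π * Complex.I * (n : ℂ) * (α : ℂ))))
      (Set.Ioi 1) := fun α hα => by
    have hα' : (1 : ℝ) < α := hα
    have hα₀ : (α : ℂ) ≠ 0 := Complex.ofReal_ne_zero.2 (by linarith)
    simp only [zeta1_sub_one hu hα'.le, zeta1_sub_one hv hα'.le, exp_neg_two_pi_I_mul_sub_one,
      neg_add, Complex.cpow_add _ _ hα₀]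
    ring
  have hlim : Filter.Tendsto (fun α : ℝ => zeta1 u α * zeta1 v α *
      Complex.exp (-(2 * π * Complex.I * (n : ℂ) * (α : ℂ)))) Filter.atTop (nhds 0) := by
    have h := ((tendsto_zeta1_atTop hu).mul (tendsto_zeta1_atTop hv)).norm
    rw [mul_zero, norm_zero] at h
    rw [tendsto_zero_iff_norm_tendsto_zero]
    simpa only [norm_mul, norm_exp_neg_two_pi_I_mul, mul_one] using h
  have hsum := (h₀.add (hzint hv hu)).add (hzint hu hv)
  rw [← integral_add' h₀ (hzint hv hu), ← integral_add' (h₀.add (hzint hv hu)) (hzint hu hv)]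
  exact (integral_Ioi_sub_shift (hlim := hlim)
    (((continuousOn_zeta1 hu).mul (continuousOn_zeta1 hv)).mul hE.continuousOn)
    (hsum.congr_fun hdiff measurableSet_Ioi)).symm.trans
      (setIntegral_congr_fun measurableSet_Ioi hdiff.symm)
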